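/- arXiv:2408.15369 — 2 statements merged into one kernel-verified Lean document; each statement's English description precedes it below -/
import Mathlib

section
/- Let δ = { δ_t^{x̄}(x,u) : t ∈ ℤ^d, x̄ ∈ X^{ℤ^d∖{t}}, x, u ∈ X } be a quasilocal one-point transition energy field, i.e., a family of real numbers satisfying: (i) δ_t^{x̄}(x,u) = δ_t^{x̄}(x,y) + δ_t^{x̄}(y,u) for all t, x̄ and x, u, y ∈ X; (ii) δ_t^{x̄y}(x,u) + δ_s^{x̄u}(y,v) = δ_s^{x̄x}(y,v) + δ_t^{x̄v}(x,u) for all t ≠ s, x̄ ∈ X^{ℤ^d∖{t,s}}, x, u ∈ X (at t), y, v ∈ X (at s); (iii) for every t, x, u the function x̄ ↦ δ_t^{x̄}(x,u) is quasilocal on X^{ℤ^d∖{t}}. Then there exists a positive random field P on X^{ℤ^d} that is a Gibbs random field and corresponds to δ: for every t ∈ ℤ^d, x̄ ∈ X^{ℤ^d∖{t}}, x, u ∈ X, and every filtration (Λ_n), the limit lim_{n→∞} ln( P_{{t}∪(Λ_n∖{t})}(x x̄_{Λ_n∖{t}}) / P_{{t}∪(Λ_n∖{t})}(u x̄_{Λ_n∖{t}})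 ) exists and equals δ_t^{x̄}(x,u). -/
open MeasureTheory Filter Topology

noncomputable section

/-- Sites of the lattice `ℤ^d`. -/
abbrev Site (d : ℕ) := Fin d → ℤ

/-- Configurations on the whole lattice. -/
abbrev Config (d : ℕ) (X : Type*) := Site d → X

variable {d : ℕ} {X : Type*}

/-- The configuration equal to `x` on `V` and to `z` off `V` (the concatenation `xz`). -/
def concat (V : Finset (Site d)) (x z : Config d X) : Config d X :=
  fun t => if t ∈ V then x t else z t

/-- The configuration equal to `u` on `I` and to `y` off `I`. -/
def extCfg (I : Finset (Site d)) (u : {s // s ∈ I} → X) (y : Config d X) : Config d X :=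
  fun t => if h : t ∈ I then u ⟨t, h⟩ else y t

/-- The cylinder set determined by the values of `z` on `Λ`. -/
def cyl (Λ : Finset (Site d)) (z : Config d X) : Set (Config d X) :=
  {ω | ∀ t ∈ Λ, ω t = z t}

/-- Finite-dimensional distribution `P_Λ(z)`. -/
def fdd [MeasurableSpace X] (P : Measure (Config d X)) (Λ : Finset (Site d))
    (z : Config d X) : ℝ :=
  (P (cyl Λ z)).toReal

/-- A positive random field: all finite-dimensional distributions are positive. -/
def IsPositiveRF [MeasurableSpace X] (P : Measure (Config d X)) : Prop :=
  ∀ Λ : Finset (Site d), Λ.Nonempty → ∀ z : Config d X, 0 < fdd P Λ z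

/-- Finite-conditional probability `g_V^z(x)` with boundary condition `z` on `Λ`. -/
def gfin [MeasurableSpace X] (P : Measure (Config d X)) (V Λ : Finset (Site d))
    (x z : Config d X) : ℝ :=
  fdd P (V ∪ Λ) (concat V x z) / fdd P Λ z

/-- A filtration: an increasing sequence of finite subsets of the lattice with union `ℤ^d`. -/
structure Filt (d : ℕ) where
  Λ : ℕ → Finset (Site d)
  mono : Monotone Λ
  covers : ∀ t : Site d, ∃ n, t ∈ Λ n

/-- The set `𝒳_V(F)` of admissible boundary conditions: those `x̄` for which all the limits
`lim_n g_V^{x̄_{Λ_n ∖ V}}(x)` exist. (Only the values of `x̄` off `V` are ever used.) -/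
def admissible [MeasurableSpace X] (P : Measure (Config d X)) (V : Finset (Site d))
    (F : Filt d) : Set (Config d X) :=
  {xb | ∀ x : Config d X, ∃ L : ℝ,
    Tendsto (fun n => gfin P V (F.Λ n \ V) x xb) atTop (𝓝 L)}

/-- The conditional probability `g_V^{x̄}(x)` : the limit of `g_V^{x̄_{Λ_n ∖ V}}(x)`. -/
def gCond [MeasurableSpace X] (P : Measure (Config d X)) (V : Finset (Site d))
    (F : Filt d) (xb x : Config d X) : ℝ :=
  limUnder atTop (fun n => gfin P V (F.Λ n \ V) x xb)

/-- Transition energy `Δ_V^{x̄}(x,u) = ln (g_V^{x̄}(x) / g_V^{x̄}(u))`. -/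
def TE [MeasurableSpace X] (P : Measure (Config d X)) (V : Finset (Site d))
    (F : Filt d) (xb x u : Config d X) : ℝ :=
  Real.log (gCond P V F xb x / gCond P V F xb u)

/-- Quasilocality (on boundary conditions off `V`) of a function `h` on a set `Y` of
boundary conditions. -/
def QuasilocalOn (V : Finset (Site d)) (Y : Set (Config d X)) (h : Config d X → ℝ) : Prop :=
  ∀ ε > 0, ∃ Λε : Finset (Site d), Disjoint Λε V ∧
    ∀ Λ : Finset (Site d), Disjoint Λ V → Λε ⊆ Λ →
      ∀ xb ∈ Y, ∀ yb ∈ Y, (∀ s ∈ Λ, xb s = yb s) → |h xb - h yb| < ε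

/-- `Y` represents a set of boundary conditions on `ℤ^d ∖ {t}`: membership does not depend
on the value at `t`. -/
def IsBCSet (t : Site d) (Y : Set (Config d X)) : Prop :=
  ∀ (ω : Config d X) (a : X), ω ∈ Y → Function.update ω t a ∈ Y

/-- `F` is a determining filtration for `P` with sets `Y t` of admissible boundary conditions:
the one-point finite-conditional probabilities converge, uniformly over `Y t`, to positive
limits, and `P(Y t) = 1`. -/
structure IsDetermining [MeasurableSpace X] (P : Measure (Config d X)) (F : Filt d)
    (Y : Site d → Set (Config d X)) : Prop where
  meas : ∀ t, MeasurableSet (Y t)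
  bc : ∀ t, IsBCSet t (Y t)
  adm : ∀ t, Y t ⊆ admissible P {t} F
  full : ∀ t, P (Y t) = 1
  pos : ∀ t, ∀ xb ∈ Y t, ∀ x : X, 0 < gCond P {t} F xb (fun _ => x)
  unif : ∀ (t : Site d) (x : X), ∀ ε > 0, ∃ N, ∀ n ≥ N, ∀ xb ∈ Y t,
    |gfin P {t} (F.Λ n \ {t}) (fun _ => x) xb - gCond P {t} F xb (fun _ => x)| < ε

/-- The probabilistic (Pr--) definition of a Gibbs random field. -/
def IsGibbsRF [MeasurableSpace X] (P : Measure (Config d X)) : Prop :=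
  IsProbabilityMeasure P ∧ IsPositiveRF P ∧
    ∃ (F : Filt d) (Y : Site d → Set (Config d X)), IsDetermining P F Y

/-- The one-site energy inequality for sites in `V`: an upper bound `c` for `δ_t^ω(x,u)` over all
boundary conditions `ω` agreeing with `xb` on `Λ` bounds the probability of `x` at `t`
by `exp c` times the probability of `u` at `t`. -/
def HasEnergyOn [MeasurableSpace X] (δ : Site d → Config d X → X → X → ℝ)
    (P : Measure (Config d X)) (V : Finset (Site d)) : Prop :=
  ∀ t ∈ V, ∀ Λ : Finset (Site d), t ∉ Λ → ∀ (xb : Config d X) (x u : X) (c : ℝ),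
    (∀ ω : Config d X, (∀ s ∈ Λ, ω s = xb s) → δ t ω x u ≤ c) →
    fdd P (insert t Λ) (Function.update xb t x) ≤
      Real.exp c * fdd P (insert t Λ) (Function.update xb t u)

theorem mem_cyl_insert_update {t : Site d} {Λ : Finset (Site d)} (ht : t ∉ Λ)
    (xb ω : Config d X) (x : X) :
    ω ∈ cyl (insert t Λ) (Function.update xb t x) ↔ ω t = x ∧ ∀ s ∈ Λ, ω s = xb s := by
  simp only [cyl, Set.mem_ofPred_eq, Finset.mem_insert, forall_eq_or_imp, Function.update_self]
  refine and_congr_right fun _ => forall₂_congr fun s hs => ?_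
  rw [Function.update_of_ne (ne_of_mem_of_not_mem hs ht)]

theorem measurableSet_cyl [MeasurableSpace X] [MeasurableSingletonClass X]
    (Λ : Finset (Site d)) (z : Config d X) : MeasurableSet (cyl Λ z) := by
  have : cyl Λ z = ⋂ t ∈ Λ, (fun ω : Config d X => ω t) ⁻¹' {z t} := by
    ext ω; simp [cyl]
  rw [this]
  exact Λ.measurableSet_biInter fun t _ => measurable_pi_apply t (measurableSet_singleton _)

theorem isClopen_cyl [TopologicalSpace X] [DiscreteTopology X]
    (Λ : Finset (Site d)) (z : Config d X) : IsClopen (cyl Λ z) := by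
  have : cyl Λ z = ⋂ t ∈ Λ, (fun ω : Config d X => ω t) ⁻¹' {z t} := by
    ext ω; simp [cyl]
  rw [this]
  exact isClopen_biInter_finset fun t _ => (isClopen_discrete _).preimage (continuous_apply t)

theorem cyl_congr {Λ : Finset (Site d)} {z z' : Config d X} (h : ∀ s ∈ Λ, z s = z' s) :
    cyl Λ z = cyl Λ z' := by
  ext ω
  exact forall₂_congr fun s hs => by rw [h s hs]

theorem fdd_eq_sum_insert [Fintype X] [MeasurableSpace X] [MeasurableSingletonClass X]
    (P : Measure (Config d X)) [IsFiniteMeasure P] {t : Site d} {Λ : Finset (Site d)}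
    (ht : t ∉ Λ) (xb : Config d X) :
    fdd P Λ xb = ∑ u, fdd P (insert t Λ) (Function.update xb t u) := by
  have hU : cyl Λ xb = ⋃ u ∈ (Finset.univ : Finset X),
      cyl (insert t Λ) (Function.update xb t u) := by
    ext ω
    simp only [Set.mem_iUnion, mem_cyl_insert_update ht, Finset.mem_univ, exists_prop, true_and]
    simp [cyl]
  change P.real _ = ∑ u, P.real _
  rw [hU, measureReal_biUnion_finset]
  · intro u _ v _ huv
    refine Set.disjoint_left.2 fun ω h1 h2 => huv ?_
    rw [mem_cyl_insert_update ht] at h1 h2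
    exact h1.1.symm.trans h2.1
  · exact fun u _ => measurableSet_cyl _ _

theorem delta_self {δ : Site d → Config d X → X → X → ℝ}
    (h1 : ∀ (t : Site d) (xb : Config d X) (x u y : X),
      δ t xb x u = δ t xb x y + δ t xb y u) (t : Site d) (xb : Config d X) (x : X) :
    δ t xb x x = 0 := by
  linarith [h1 t xb x x x]

theorem QuasilocalOn.eq_update {t : Site d} {h : Config d X → ℝ}
    (hq : QuasilocalOn {t} Set.univ h) (ω : Config d X) (a : X) :
    h (Function.update ω t a) = h ω := by
  refine eq_of_abs_sub_le_all fun ε hε => ?_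
  obtain ⟨Λ, hΛ, H⟩ := hq ε hε
  refine (H Λ hΛ subset_rfl _ trivial _ trivial fun s hs => ?_).le
  rw [Function.update_of_ne]
  rintro rfl
  simp at hΛ
  exact hΛ hs

theorem QuasilocalOn.bddAbove [Finite X] [Nonempty X] {V : Finset (Site d)} {h : Config d X → ℝ}
    (hq : QuasilocalOn V Set.univ h) : ∃ c, ∀ ω, h ω ≤ c := by
  obtain ⟨Λ, hΛ, H⟩ := hq 1 one_pos
  let b : Config d X := fun _ => Classical.arbitrary X
  obtain ⟨M, hM⟩ := (Set.finite_range fun v : {s // s ∈ Λ} → X => h (extCfg Λ v b)).bddAbove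
  refine ⟨M + 1, fun ω => ?_⟩
  have h2 := hM ⟨fun s => ω s, rfl⟩
  have h3 := H Λ hΛ subset_rfl ω trivial (extCfg Λ (fun s => ω s) b) trivial
    fun s hs => by simp [extCfg, hs]
  have := (abs_lt.1 h3).2
  dsimp only at h2
  linarith

/-- Finite-volume Hamiltonian: a one-point transition energy field is, on every finite set
of sites, the field of increments of a single function of the configuration. -/
theorem exists_hamiltonian [Nonempty X] {δ : Site d → Config d X → X → X → ℝ}
    (h1 : ∀ (t : Site d) (xb : Config d X) (x u y : X),
      δ t xb x u = δ t xb x y + δ t xb y u)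
    (h2 : ∀ t s : Site d, t ≠ s → ∀ (xb : Config d X) (x u y v : X),
      δ t (Function.update xb s y) x u + δ s (Function.update xb t u) y v =
        δ s (Function.update xb t x) y v + δ t (Function.update xb s v) x u)
    (h3 : ∀ (t : Site d) (x u : X),
      QuasilocalOn {t} Set.univ (fun xb => δ t xb x u)) (V : Finset (Site d)) :
    ∃ H : Config d X → ℝ, ∀ t ∈ V, ∀ (ω : Config d X) (x u : X),
      H (Function.update ω t x) - H (Function.update ω t u) = δ t ω x u := by
  induction V using Finset.induction_on with
  | empty => exact ⟨0, by simp⟩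
  | insert s V hs ih =>
    obtain ⟨H, hH⟩ := ih
    let b := Classical.arbitrary X
    refine ⟨fun ω => δ s ω (ω s) b + H (Function.update ω s b), fun t ht ω x u => ?_⟩
    by_cases hts : t = s
    · subst hts
      have e : ∀ x, δ t (Function.update ω t x) x b = δ t ω x b :=
        fun x => (h3 t x b).eq_update ω x
      simp only [Function.update_self, Function.update_idem, e]
      linarith [h1 t ω x b u]
    · have htV : t ∈ V := (Finset.mem_insert.1 ht).resolve_left hts
      have k := h2 t s hts ω x u (ω s) b
      rw [Function.update_eq_self] at k
      have k' := hH t htV (Function.update ω s b) x u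
      have e : ∀ a, Function.update (Function.update ω t a) s b =
          Function.update (Function.update ω s b) t a :=
        fun a => Function.update_comm hts a b ω
      simp only [Function.update_of_ne (Ne.symm hts), e]
      linarith

theorem extCfg_update {V : Finset (Site d)} {t : Site d} (ht : t ∈ V)
    (v : {s // s ∈ V} → X) (b : Config d X) (u : X) :
    extCfg V (Function.update v ⟨t, ht⟩ u) b = Function.update (extCfg V v b) t u := by
  ext s
  by_cases hst : s = t
  · subst hst
    simp [extCfg, ht]
  · by_cases hs : s ∈ V <;> simp [extCfg, hs, hst, Function.update_of_ne]

theorem exists_finite_volume_measure [Fintype X] [Nonempty X] [MeasurableSpace X]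
    [MeasurableSingletonClass X] {δ : Site d → Config d X → X → X → ℝ} {V : Finset (Site d)}
    {H : Config d X → ℝ} (hH : ∀ t ∈ V, ∀ (ω : Config d X) (x u : X),
      H (Function.update ω t x) - H (Function.update ω t u) = δ t ω x u) :
    ∃ P : ProbabilityMeasure (Config d X), HasEnergyOn δ (P : Measure (Config d X)) V := by
  classical
  let b : Config d X := fun _ => Classical.arbitrary X
  let e : ({s // s ∈ V} → X) → Config d X := fun v => extCfg V v b
  let Z : ℝ := ∑ v, Real.exp (H (e v))
  have hZ : 0 < Z := Finset.sum_pos (fun v _ => Real.exp_pos _) Finset.univ_nonempty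
  let w : ({s // s ∈ V} → X) → ℝ := fun v => Real.exp (H (e v)) / Z
  have hw : ∀ v, 0 ≤ w v := fun v => by positivity
  have hw1 : ∑ v, w v = 1 := by
    rw [← Finset.sum_div]
    exact div_self hZ.ne'
  let μ : Measure (Config d X) := ∑ v, ENNReal.ofReal (w v) • Measure.dirac (e v)
  have hμ : IsProbabilityMeasure μ := ⟨by
    simp only [μ, Measure.coe_finsetSum, Finset.sum_apply, Measure.smul_apply, measure_univ,
      smul_eq_mul, mul_one]
    rw [← ENNReal.ofReal_sum_of_nonneg fun v _ => hw v, hw1, ENNReal.ofReal_one]⟩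
  have hfdd : ∀ Λ z, fdd μ Λ z = ∑ v with e v ∈ cyl Λ z, w v := fun Λ z => by
    have : μ (cyl Λ z) = ENNReal.ofReal (∑ v with e v ∈ cyl Λ z, w v) := by
      simp only [μ, Measure.coe_finsetSum, Finset.sum_apply, Measure.smul_apply, smul_eq_mul,
        Measure.dirac_apply' _ (measurableSet_cyl Λ z)]
      rw [ENNReal.ofReal_sum_of_nonneg fun v _ => hw v, Finset.sum_filter]
      refine Finset.sum_congr rfl fun v _ => ?_
      by_cases hv : e v ∈ cyl Λ z <;> simp [hv]
    rw [fdd, this, ENNReal.toReal_ofReal (Finset.sum_nonneg fun v _ => hw v)]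
  refine ⟨⟨μ, hμ⟩, fun t ht Λ htΛ xb x u c hc => ?_⟩
  have he : ∀ v a, e (Function.update v ⟨t, ht⟩ a) = Function.update (e v) t a :=
    fun v a => extCfg_update ht v b a
  have het : ∀ v, e v t = v ⟨t, ht⟩ := fun v => by simp [e, extCfg, ht]
  have hmem : ∀ v a a', e v ∈ cyl (insert t Λ) (Function.update xb t a) →
      e (Function.update v ⟨t, ht⟩ a') ∈ cyl (insert t Λ) (Function.update xb t a') := by
    intro v a a' hv
    rw [mem_cyl_insert_update htΛ] at hv ⊢
    rw [he]
    refine ⟨Function.update_self .., fun s hs => ?_⟩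
    rw [Function.update_of_ne (ne_of_mem_of_not_mem hs htΛ), hv.2 s hs]
  have hinv : ∀ v a a', e v ∈ cyl (insert t Λ) (Function.update xb t a) →
      Function.update (Function.update v ⟨t, ht⟩ a') ⟨t, ht⟩ a = v := by
    intro v a a' hv
    rw [mem_cyl_insert_update htΛ, het] at hv
    rw [Function.update_idem, ← hv.1, Function.update_eq_self]
  change fdd μ _ _ ≤ _ * fdd μ _ _
  rw [hfdd, hfdd]
  calc ∑ v with e v ∈ cyl (insert t Λ) (Function.update xb t x), w v
      ≤ ∑ v with e v ∈ cyl (insert t Λ) (Function.update xb t x),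
          Real.exp c * w (Function.update v ⟨t, ht⟩ u) := by
        refine Finset.sum_le_sum fun v hv => ?_
        rw [Finset.mem_filter, mem_cyl_insert_update htΛ] at hv
        have k := hH t ht (e v) x u
        have hx : Function.update (e v) t x = e v := by
          rw [← hv.2.1, Function.update_eq_self]
        rw [hx] at k
        have k2 := hc (e v) hv.2.2
        simp only [w, he]
        rw [← mul_div_assoc, ← Real.exp_add]
        gcongr
        linarith
    _ = ∑ v with e v ∈ cyl (insert t Λ) (Function.update xb t u), Real.exp c * w v := by
        refine Finset.sum_nbij' (fun v => Function.update v ⟨t, ht⟩ u)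
          (fun v => Function.update v ⟨t, ht⟩ x) ?_ ?_ ?_ ?_ ?_
        · exact fun v hv => by
            simpa using hmem v x u (Finset.mem_filter.1 hv).2
        · exact fun v hv => by
            simpa using hmem v u x (Finset.mem_filter.1 hv).2
        · exact fun v hv => hinv v x u (Finset.mem_filter.1 hv).2
        · exact fun v hv => hinv v u x (Finset.mem_filter.1 hv).2
        · exact fun v _ => rfl
    _ = _ := by rw [Finset.mul_sum]

/-- Infinite-volume limit of measures satisfying the energy inequality in finite volumes. -/
theorem exists_infinite_volume_measure [Finite X] [MeasurableSpace X] [MeasurableSingletonClass X]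
    {δ : Site d → Config d X → X → X → ℝ}
    (h : ∀ V : Finset (Site d), ∃ P : ProbabilityMeasure (Config d X),
      HasEnergyOn δ (P : Measure (Config d X)) V) :
    ∃ P : ProbabilityMeasure (Config d X), ∀ V, HasEnergyOn δ (P : Measure (Config d X)) V := by
  let _ : TopologicalSpace X := ⊥
  have : DiscreteTopology X := ⟨rfl⟩
  have : BorelSpace X := ⟨by
    rw [borel_eq_top_of_discrete]
    exact eq_top_iff.2 fun s _ => s.toFinite.measurableSet⟩
  choose Q hQ using h
  let L : Ultrafilter (Finset (Site d)) := Ultrafilter.of atTop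
  let P : ProbabilityMeasure (Config d X) := (L.map Q).lim
  have hP : Tendsto Q L (𝓝 P) := (L.map Q).le_nhds_lim
  have hfdd : ∀ Λ z, Tendsto (fun V => fdd (Q V : Measure (Config d X)) Λ z) L
      (𝓝 (fdd (P : Measure (Config d X)) Λ z)) := fun Λ z =>
    (NNReal.tendsto_coe.2
      (ProbabilityMeasure.tendsto_measure_of_isClopen_of_tendsto hP (isClopen_cyl Λ z)))
  refine ⟨P, fun V t _ Λ htΛ xb x u c hc => ?_⟩
  refine le_of_tendsto_of_tendsto (hfdd _ _) ((hfdd _ _).const_mul _) ?_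
  have hV : ∀ᶠ V : Finset (Site d) in L, t ∈ V :=
    Ultrafilter.of_le atTop ((eventually_ge_atTop {t}).mono fun V hV => hV (by simp))
  filter_upwards [hV] with V hV
  exact hQ V t hV Λ htΛ xb x u c hc

theorem HasEnergyOn.fdd_pos [Fintype X] [MeasurableSpace X] [MeasurableSingletonClass X]
    {δ : Site d → Config d X → X → X → ℝ}
    (h3 : ∀ (t : Site d) (x u : X), QuasilocalOn {t} Set.univ (fun xb => δ t xb x u))
    {P : Measure (Config d X)} [IsProbabilityMeasure P] (hP : ∀ V, HasEnergyOn δ P V)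
    (Λ : Finset (Site d)) (z : Config d X) : 0 < fdd P Λ z := by
  induction Λ using Finset.induction_on with
  | empty => simp [fdd, cyl]
  | insert t Λ ht ih =>
    have : Nonempty X := ⟨z t⟩
    rw [fdd_eq_sum_insert P ht] at ih
    obtain ⟨u, -, hu⟩ := Finset.exists_lt_of_sum_lt (s := Finset.univ) (f := fun _ : X => (0 : ℝ))
      (by simpa using ih)
    obtain ⟨c, hc⟩ := (h3 t u (z t)).bddAbove
    have k := hP {t} t (by simp) Λ ht z u (z t) c fun ω _ => hc ω
    rw [Function.update_eq_self] at k
    exact pos_of_mul_pos_right (hu.trans_le k) (Real.exp_pos c).le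

theorem HasEnergyOn.eventually_le [Finite X] [MeasurableSpace X]
    {δ : Site d → Config d X → X → X → ℝ}
    (h3 : ∀ (t : Site d) (x u : X), QuasilocalOn {t} Set.univ (fun xb => δ t xb x u))
    {P : Measure (Config d X)} (hP : ∀ V, HasEnergyOn δ P V) (t : Site d) (F : Filt d)
    {ε : ℝ} (hε : 0 < ε) :
    ∀ᶠ n in atTop, ∀ (x u : X) (xb : Config d X),
      fdd P (insert t (F.Λ n \ {t})) (Function.update xb t x) ≤
        Real.exp (δ t xb x u + ε) * fdd P (insert t (F.Λ n \ {t})) (Function.update xb t u) := by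
  refine eventually_all.2 fun x => eventually_all.2 fun u => ?_
  obtain ⟨Λ, hΛ, H⟩ := h3 t x u ε hε
  have hF : ∀ᶠ n in atTop, ∀ s ∈ Λ, s ∈ F.Λ n := by
    refine (Finset.eventually_all Λ).2 fun s _ => ?_
    obtain ⟨N, hN⟩ := F.covers s
    exact (eventually_ge_atTop N).mono fun n hn => F.mono hn hN
  filter_upwards [hF] with n hn xb
  refine hP {t} t (by simp) _ (by simp) xb x u _ fun ω hω => ?_
  have := H (F.Λ n \ {t}) Finset.sdiff_disjoint
    (fun s hs => Finset.mem_sdiff.2 ⟨hn s hs, Finset.disjoint_left.1 hΛ hs⟩)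
    ω trivial xb trivial hω
  linarith [(abs_lt.1 this).2]

theorem HasEnergyOn.tendsto_log [Fintype X] [MeasurableSpace X] [MeasurableSingletonClass X]
    {δ : Site d → Config d X → X → X → ℝ}
    (h1 : ∀ (t : Site d) (xb : Config d X) (x u y : X),
      δ t xb x u = δ t xb x y + δ t xb y u)
    (h3 : ∀ (t : Site d) (x u : X), QuasilocalOn {t} Set.univ (fun xb => δ t xb x u))
    {P : Measure (Config d X)} [IsProbabilityMeasure P] (hP : ∀ V, HasEnergyOn δ P V)
    (t : Site d) (xb : Config d X) (x u : X) (F : Filt d) :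
    Tendsto (fun n => Real.log
        (fdd P (insert t (F.Λ n \ {t})) (Function.update xb t x) /
          fdd P (insert t (F.Λ n \ {t})) (Function.update xb t u)))
      atTop (𝓝 (δ t xb x u)) := by
  rw [Metric.tendsto_nhds]
  intro ε hε
  filter_upwards [HasEnergyOn.eventually_le h3 hP t F (half_pos hε)] with n hn
  have px := HasEnergyOn.fdd_pos h3 hP (insert t (F.Λ n \ {t})) (Function.update xb t x)
  have pu := HasEnergyOn.fdd_pos h3 hP (insert t (F.Λ n \ {t})) (Function.update xb t u)
  have a := Real.log_le_log px (hn x u xb)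
  have b := Real.log_le_log pu (hn u x xb)
  rw [Real.log_mul (Real.exp_ne_zero _) (ne_of_gt ‹_›), Real.log_exp] at a b
  rw [Real.log_div px.ne' pu.ne', Real.dist_eq, abs_lt]
  have := h1 t xb x x u
  rw [delta_self h1] at this
  constructor <;> linarith

theorem gfin_singleton [MeasurableSpace X] (P : Measure (Config d X)) (t : Site d)
    (Λ : Finset (Site d)) (x xb : Config d X) :
    gfin P {t} Λ x xb = fdd P (insert t Λ) (Function.update xb t (x t)) / fdd P Λ xb := by
  have : concat {t} x xb = Function.update xb t (x t) := by
    ext s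
    by_cases hs : s = t
    · subst hs; simp [concat]
    · simp [concat, hs]
  rw [gfin, this, ← Finset.insert_eq]

theorem HasEnergyOn.eventually_abs_gfin_sub_le [Fintype X] [MeasurableSpace X]
    [MeasurableSingletonClass X] {δ : Site d → Config d X → X → X → ℝ}
    (h1 : ∀ (t : Site d) (xb : Config d X) (x u y : X),
      δ t xb x u = δ t xb x y + δ t xb y u)
    (h3 : ∀ (t : Site d) (x u : X), QuasilocalOn {t} Set.univ (fun xb => δ t xb x u))
    {P : Measure (Config d X)} [IsProbabilityMeasure P] (hP : ∀ V, HasEnergyOn δ P V)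
    (t : Site d) (F : Filt d) {ε : ℝ} (hε : 0 < ε) :
    ∀ᶠ n in atTop, ∀ (x xb : Config d X),
      |gfin P {t} (F.Λ n \ {t}) x xb - (∑ u, Real.exp (δ t xb u (x t)))⁻¹| < ε := by
  have hexp : ∀ᶠ η in 𝓝[>] (0 : ℝ), Real.exp η < 1 + ε :=
    nhdsWithin_le_nhds ((Real.continuous_exp.tendsto 0).eventually_lt_const (by simpa))
  obtain ⟨η, hη, hη0⟩ := (hexp.and self_mem_nhdsWithin).exists
  filter_upwards [HasEnergyOn.eventually_le h3 hP t F hη0] with n hn x xb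
  set Λ := F.Λ n \ {t}
  set p := fun u => fdd P (insert t Λ) (Function.update xb t u)
  have hp : ∀ u, 0 < p u := fun u => HasEnergyOn.fdd_pos h3 hP _ _
  set B := ∑ u, Real.exp (δ t xb u (x t))
  have hB : 1 ≤ B := by
    have := Finset.single_le_sum (f := fun u => Real.exp (δ t xb u (x t)))
      (fun u _ => (Real.exp_pos _).le) (Finset.mem_univ (x t))
    rwa [delta_self h1, Real.exp_zero] at this
  have hsum : fdd P Λ xb = ∑ u, p u := fdd_eq_sum_insert P (by simp [Λ]) xb
  have hup : fdd P Λ xb ≤ Real.exp η * B * p (x t) := by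
    rw [hsum, Finset.mul_sum, Finset.sum_mul]
    refine Finset.sum_le_sum fun u _ => (hn u (x t) xb).trans_eq ?_
    rw [Real.exp_add, mul_comm (Real.exp η)]
  have hlo : B * p (x t) ≤ Real.exp η * fdd P Λ xb := by
    rw [hsum, Finset.mul_sum, Finset.sum_mul]
    refine Finset.sum_le_sum fun u _ => ?_
    have k := hn (x t) u xb
    have e := h1 t xb u u (x t)
    rw [delta_self h1] at e
    calc _ ≤ Real.exp (δ t xb u (x t)) * (Real.exp (δ t xb (x t) u + η) * p u) := by gcongr
      _ = Real.exp η * p u := by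
        rw [← mul_assoc, ← Real.exp_add]
        congr 2
        linarith
  have hΛ : 0 < fdd P Λ xb := HasEnergyOn.fdd_pos h3 hP _ _
  have hB0 : 0 < B := one_pos.trans_le hB
  rw [gfin_singleton]
  change |p (x t) / fdd P Λ xb - _| < ε
  have hBi : B⁻¹ ≤ 1 := inv_le_one_of_one_le₀ hB
  have hBi0 : 0 < B⁻¹ := inv_pos.2 hB0
  have u1 : p (x t) / fdd P Λ xb ≤ Real.exp η * B⁻¹ := by
    rw [div_le_iff₀ hΛ, mul_right_comm, ← div_eq_mul_inv, le_div_iff₀ hB0, mul_comm]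
    exact hlo
  have l1 : B⁻¹ ≤ Real.exp η * (p (x t) / fdd P Λ xb) := by
    rw [← mul_div_assoc, le_div_iff₀ hΛ, inv_mul_le_iff₀ hB0]
    linarith
  have h1p : p (x t) / fdd P Λ xb ≤ 1 := by
    rw [div_le_one hΛ, hsum]
    exact Finset.single_le_sum (fun u _ => (hp u).le) (Finset.mem_univ _)
  have h0p : 0 < p (x t) / fdd P Λ xb := div_pos (hp _) hΛ
  rw [abs_lt]
  constructor <;> nlinarith

/-- The filtration of `ℤ^d` by centred cubes. -/
def cubeFilt (d : ℕ) : Filt d where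
  Λ n := Fintype.piFinset fun _ => Finset.Icc (-(n : ℤ)) n
  mono m n h := Fintype.piFinset_subset _ _ fun _ => Finset.Icc_subset_Icc (by lia) (by lia)
  covers t := by
    refine ⟨∑ i, (t i).natAbs, Fintype.mem_piFinset.2 fun i => ?_⟩
    have := Finset.single_le_sum (f := fun i => (t i).natAbs) (fun _ _ => Nat.zero_le _)
      (Finset.mem_univ i)
    rw [Finset.mem_Icc]
    lia

theorem HasEnergyOn.isGibbsRF [Fintype X] [MeasurableSpace X] [MeasurableSingletonClass X]
    {δ : Site d → Config d X → X → X → ℝ}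
    (h1 : ∀ (t : Site d) (xb : Config d X) (x u y : X),
      δ t xb x u = δ t xb x y + δ t xb y u)
    (h3 : ∀ (t : Site d) (x u : X), QuasilocalOn {t} Set.univ (fun xb => δ t xb x u))
    {P : Measure (Config d X)} [hPr : IsProbabilityMeasure P] (hP : ∀ V, HasEnergyOn δ P V) :
    IsGibbsRF P := by
  have key := fun t {ε : ℝ} (hε : 0 < ε) =>
    HasEnergyOn.eventually_abs_gfin_sub_le h1 h3 hP t (cubeFilt d) hε
  have lim : ∀ (t : Site d) (x xb : Config d X),
      Tendsto (fun n => gfin P {t} ((cubeFilt d).Λ n \ {t}) x xb) atTop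
        (𝓝 (∑ u, Real.exp (δ t xb u (x t)))⁻¹) := fun t x xb =>
    Metric.tendsto_nhds.2 fun ε hε => (key t hε).mono fun n hn => hn x xb
  have hg : ∀ (t : Site d) (xb x : Config d X),
      gCond P {t} (cubeFilt d) xb x = (∑ u, Real.exp (δ t xb u (x t)))⁻¹ :=
    fun t xb x => (lim t x xb).limUnder_eq
  refine ⟨hPr, fun Λ _ z => HasEnergyOn.fdd_pos h3 hP Λ z, cubeFilt d, fun _ => Set.univ, ?_⟩
  refine ⟨fun _ => MeasurableSet.univ, fun _ _ _ _ => trivial, fun t xb _ x => ⟨_, lim t x xb⟩,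
    fun _ => measure_univ, fun t xb _ x => ?_, fun t x ε hε => ?_⟩
  · rw [hg]
    exact inv_pos.2 (Finset.sum_pos (fun _ _ => Real.exp_pos _) ⟨x, Finset.mem_univ x⟩)
  · obtain ⟨N, hN⟩ := eventually_atTop.1 (key t hε)
    refine ⟨N, fun n hn xb _ => ?_⟩
    rw [hg]
    exact hN n hn _ xb

/-- Theorem 5 / `th-exist-Gibbs-delta`: representation theorem — existence of
a Gibbs random field corresponding to a quasilocal one-point transition energy field. -/
theorem stmt15 [Fintype X] [Nontrivial X] [MeasurableSpace X] [MeasurableSingletonClass X]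
    (δ : Site d → Config d X → X → X → ℝ)
    (h1 : ∀ (t : Site d) (xb : Config d X) (x u y : X),
      δ t xb x u = δ t xb x y + δ t xb y u)
    (h2 : ∀ t s : Site d, t ≠ s → ∀ (xb : Config d X) (x u y v : X),
      δ t (Function.update xb s y) x u + δ s (Function.update xb t u) y v =
        δ s (Function.update xb t x) y v + δ t (Function.update xb s v) x u)
    (h3 : ∀ (t : Site d) (x u : X),
      QuasilocalOn {t} Set.univ (fun xb => δ t xb x u)) :
    ∃ P : Measure (Config d X), IsGibbsRF P ∧
      ∀ (t : Site d) (xb : Config d X) (x u : X) (F : Filt d),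
        Tendsto (fun n => Real.log
            (fdd P (insert t (F.Λ n \ {t})) (Function.update xb t x) /
              fdd P (insert t (F.Λ n \ {t})) (Function.update xb t u)))
          atTop (𝓝 (δ t xb x u)) := by
  obtain ⟨P, hP⟩ := exists_infinite_volume_measure (δ := δ) fun V =>
    (exists_hamiltonian h1 h2 h3 V).elim fun _ hH => exists_finite_volume_measure hH
  exact ⟨P, HasEnergyOn.isGibbsRF h1 h3 hP, HasEnergyOn.tendsto_log h1 h3 hP⟩
end
end

section
/- Let X be a finite set with at least two elements and d ≥ 1. (a) Suppose H = { H_t^{x̄} : X → ℝ, t ∈ ℤ^d, x̄ ∈ X^{ℤ^d∖{t}} } is a one-point Hamiltonian, i.e., for all t ≠ s in ℤ^d, x̄ ∈ X^{ℤ^d∖{t,s}}, x, u ∈ X (value at t) and y, v ∈ X (value at s): H_t^{x̄y}(x) + H_s^{x̄x}(v) + H_t^{x̄v}(u) + H_s^{x̄u}(y) = H_t^{x̄y}(u) + H_s^{x̄u}(v) + H_t^{x̄v}(x) + H_s^{x̄x}(y). Then the family δ_t^{x̄}(x,u) := H_t^{x̄}(u) − H_t^{x̄}(x) is a one-point transition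 energy field, i.e., it satisfies δ_t^{x̄}(x,u) = δ_t^{x̄}(x,y) + δ_t^{x̄}(y,u) for all x, u, y ∈ X, and δ_t^{x̄y}(x,u) + δ_s^{x̄u}(y,v) = δ_s^{x̄x}(y,v) + δ_t^{x̄v}(x,u) for all t ≠ s and all configurations as above. (b) Conversely, every one-point transition energy field δ arises in this way: there exists a one-point Hamiltonian H with δ_t^{x̄}(x,u) = H_t^{x̄}(u) − H_t^{x̄}(x) for all t, x̄, x, u. -/
noncomputable section

/-- A one-point Hamiltonian: consistency condition for the functions `H_t^{x̄}`. -/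
def IsOnePointHamiltonian {d : ℕ} {X : Type*} (H : Site d → Config d X → X → ℝ) : Prop :=
  ∀ t s : Site d, t ≠ s → ∀ (xb : Config d X) (x u y v : X),
    H t (Function.update xb s y) x + H s (Function.update xb t x) v +
        H t (Function.update xb s v) u + H s (Function.update xb t u) y =
      H t (Function.update xb s y) u + H s (Function.update xb t u) v +
        H t (Function.update xb s v) x + H s (Function.update xb t x) y

/-- A one-point transition energy field: additivity and consistency conditions for the
functions `δ_t^{x̄}(x,u)`. -/
def IsOnePointTEField {d : ℕ} {X : Type*} (δ : Site d → Config d X → X → X → ℝ) : Prop :=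
  (∀ (t : Site d) (xb : Config d X) (x u y : X),
    δ t xb x u = δ t xb x y + δ t xb y u) ∧
  (∀ t s : Site d, t ≠ s → ∀ (xb : Config d X) (x u y v : X),
    δ t (Function.update xb s y) x u + δ s (Function.update xb t u) y v =
      δ s (Function.update xb t x) y v + δ t (Function.update xb s v) x u)

/-- (a) the differences of a one-point Hamiltonian form a one-point
transition energy field; (b) conversely, every one-point transition energy field arises
in this way from some one-point Hamiltonian. -/
theorem stmt16 {d : ℕ} {X : Type*} [Fintype X] [Nontrivial X] :
    (∀ H : Site d → Config d X → X → ℝ, IsOnePointHamiltonian H →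
      IsOnePointTEField (fun t xb x u => H t xb u - H t xb x)) ∧
    (∀ δ : Site d → Config d X → X → X → ℝ, IsOnePointTEField δ →
      ∃ H : Site d → Config d X → X → ℝ, IsOnePointHamiltonian H ∧
        ∀ (t : Site d) (xb : Config d X) (x u : X),
          δ t xb x u = H t xb u - H t xb x) := by
  refine ⟨fun H hH => ⟨fun t xb x u y => by ring, fun t s hts xb x u y v => ?_⟩,
    fun δ ⟨hadd, hcomm⟩ => ?_⟩
  · linarith [hH t s hts xb x u y v]
  · obtain ⟨c⟩ : Nonempty X := inferInstance
    refine ⟨fun t xb x => δ t xb c x, fun t s hts xb x u y v => ?_, fun t xb x u => ?_⟩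
    · linarith [hcomm t s hts xb x u y v,
        hadd t (Function.update xb s y) c u x, hadd t (Function.update xb s v) c u x,
        hadd s (Function.update xb t x) c v y, hadd s (Function.update xb t u) c v y]
    · linarith [hadd t xb c u x]
end
end
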